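/- arXiv:1912.04175 — 2 statements merged into one kernel-verified Lean document; each statement's English description precedes it below -/
import Mathlib

section
/- Let C : ℝ^p × ℝ^q → ℝ be twice continuously differentiable. Fix θ ∈ ℝ^q and a ∈ ℝ^p such that the gradient ∇_a C(a,θ) = 0 and the Hessian C^{aa} = ∇²_{aa}C(a,θ) is positive definite, and let C^{aθ} = (∂²C/∂a_i∂θ_j)(a,θ) be the mixed second-derivative matrix. For ϑ in a neighborhood of θ let a(ϑ) denote the unique local minimizer of C(·,ϑ) near a (so a(θ) = a), which exists and is continuously differentiable by the implicit function theorem. Let (θ̂_n) be a sequence of ℝ^q-valued random vectors such that √n(θ̂_n − θ) converges in distribution to a centered Gaussian vector N with covariance matrix Σ. Then n·(C(a(θ̂_n),θ) − C(a,θ)) converges in distribution to the Gaussian quadratic form Nᵀ Q N, where Q = ½ (C^{aθ})ᵀ (C^{aa})⁻¹ C^{aθ}. -/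
open MeasureTheory ProbabilityTheory Matrix Filter Topology
open Asymptotics

/-- Second-order Taylor expansion at a critical point, with Peano remainder. -/
theorem isLittleO_sub_half_sndFDeriv {E : Type*} [NormedAddCommGroup E] [NormedSpace ℝ E]
    {g : E → ℝ} (hg : ContDiff ℝ 2 g) {a : E} (ha : fderiv ℝ g a = 0) :
    (fun b => g b - g a - 1 / 2 * fderiv ℝ (fderiv ℝ g) a (b - a) (b - a))
      =o[𝓝 a] fun b => ‖b - a‖ ^ 2 := by
  set B := fderiv ℝ (fderiv ℝ g) a
  have hsymm : ∀ v w, B v w = B w v :=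
    (hg.contDiffAt.isSymmSndFDerivAt (by simp)).eq
  have hB' : HasFDerivAt (fderiv ℝ g) B a :=
    ((hg.fderiv_right (m := 1) le_rfl).differentiable (by simp) a).hasFDerivAt
  have hderiv : ∀ b, HasFDerivAt (fun b => g b - 1 / 2 * B (b - a) (b - a))
      (fderiv ℝ g b - B (b - a)) b := by
    intro b
    have h1 : HasFDerivAt g (fderiv ℝ g b) b := (hg.differentiable (by simp) b).hasFDerivAt
    have h2 : HasFDerivAt (fun b => b - a) (ContinuousLinearMap.id ℝ E) b :=
      (hasFDerivAt_id b).sub_const a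
    have h3 : HasFDerivAt (fun b => B (b - a)) (B.comp (ContinuousLinearMap.id ℝ E)) b :=
      B.hasFDerivAt.comp b h2
    refine (h1.sub ((h3.clm_apply h2).const_mul (1 / 2))).congr_fderiv ?_
    ext v
    simp only [_root_.sub_apply, _root_.add_apply, _root_.smul_apply, smul_eq_mul,
      ContinuousLinearMap.comp_apply, ContinuousLinearMap.flip_apply, ContinuousLinearMap.id_apply,
      hsymm v (b - a)]
    ring
  have key := convex_univ.isLittleO_pow_succ (n := 1) (Set.mem_univ a)
    (fun b _ => (hderiv b).hasFDerivWithinAt) (by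
      have h := hB'.isLittleO
      simp only [ha, sub_zero] at h
      simpa [nhdsWithin_univ] using h.norm_right)
  simp only [nhdsWithin_univ, sub_self, map_zero, mul_zero, sub_zero] at key
  refine key.congr (fun b => ?_) (fun b => rfl)
  ring

/-- Second-order expansion of a function composed with a differentiable map sending the base point
to a critical point. -/
theorem isLittleO_comp_sub_half_sndFDeriv {E F : Type*} [NormedAddCommGroup E] [NormedSpace ℝ E]
    [NormedAddCommGroup F] [NormedSpace ℝ F]
    {g : E → ℝ} (hg : ContDiff ℝ 2 g) {A : F → E} {A' : F →L[ℝ] E} {θ : F}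
    (hA : HasFDerivAt A A' θ) (ha : fderiv ℝ g (A θ) = 0) :
    (fun ϑ => g (A ϑ) - g (A θ)
        - 1 / 2 * fderiv ℝ (fderiv ℝ g) (A θ) (A' (ϑ - θ)) (A' (ϑ - θ)))
      =o[𝓝 θ] fun ϑ => ‖ϑ - θ‖ ^ 2 := by
  set B := fderiv ℝ (fderiv ℝ g) (A θ)
  have hO : (fun ϑ => A ϑ - A θ) =O[𝓝 θ] fun ϑ => ϑ - θ := hA.isBigO_sub
  have h1 : (fun ϑ => g (A ϑ) - g (A θ) - 1 / 2 * B (A ϑ - A θ) (A ϑ - A θ))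
      =o[𝓝 θ] fun ϑ => ‖ϑ - θ‖ ^ 2 :=
    ((isLittleO_sub_half_sndFDeriv hg ha).comp_tendsto hA.continuousAt).trans_isBigO
      (hO.norm_norm.pow 2)
  have hr : (fun ϑ => A ϑ - A θ - A' (ϑ - θ)) =o[𝓝 θ] fun ϑ => ϑ - θ := hA.isLittleO
  have hA' : (fun ϑ => A' (ϑ - θ)) =O[𝓝 θ] fun ϑ => ϑ - θ := A'.isBigO_sub _ _
  have hBb : ∀ u v : F → E, (fun ϑ => B (u ϑ) (v ϑ)) =O[𝓝 θ] fun ϑ => ‖u ϑ‖ * ‖v ϑ‖ := by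
    intro u v
    refine IsBigO.of_bound ‖B‖ (Eventually.of_forall fun ϑ => ?_)
    simpa [mul_assoc] using B.le_opNorm₂ (u ϑ) (v ϑ)
  have h2 : (fun ϑ => B (A ϑ - A θ - A' (ϑ - θ)) (A ϑ - A θ)) =o[𝓝 θ] fun ϑ => ‖ϑ - θ‖ ^ 2 := by
    refine (hBb _ _).trans_isLittleO ?_
    simpa [pow_two] using hr.norm_norm.mul_isBigO hO.norm_norm
  have h3 : (fun ϑ => B (A' (ϑ - θ)) (A ϑ - A θ - A' (ϑ - θ))) =o[𝓝 θ] fun ϑ => ‖ϑ - θ‖ ^ 2 := by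
    refine (hBb _ _).trans_isLittleO ?_
    simpa [pow_two] using hA'.norm_norm.mul_isLittleO hr.norm_norm
  refine (h1.add ((h2.add h3).const_mul_left (1 / 2))).congr (fun ϑ => ?_) (fun ϑ => rfl)
  simp only [map_sub, _root_.sub_apply]
  ring

/-- The partial derivative in the first variable of a `C²` function is differentiable. -/
theorem ContDiff.differentiable_fderiv_fst {E F : Type*} [NormedAddCommGroup E]
    [NormedSpace ℝ E] [NormedAddCommGroup F] [NormedSpace ℝ F] {C : E → F → ℝ}
    (hC : ContDiff ℝ 2 (fun x : E × F => C x.1 x.2)) :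
    Differentiable ℝ (fun x : E × F => fderiv ℝ (fun b => C b x.2) x.1) := by
  have hG : (fun x : E × F => fderiv ℝ (fun b => C b x.2) x.1) = fun x =>
      (fderiv ℝ (fun x : E × F => C x.1 x.2) x).comp (ContinuousLinearMap.inl ℝ E F) := by
    ext1 x
    exact (HasFDerivAt.comp (f := fun b => (b, x.2)) x.1
      (hC.differentiable (by simp) x).hasFDerivAt (hasFDerivAt_prodMk_left x.1 x.2)).fderiv
  rw [hG]
  exact ((hC.fderiv_right (m := 1) le_rfl).clm_comp contDiff_const).differentiable (by simp)

/-- Derivative of a parametrized critical point `ϑ ↦ A ϑ` of `C (·, ϑ)`. -/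
theorem sndFDeriv_apply_of_eventually_critical {E F : Type*} [NormedAddCommGroup E]
    [NormedSpace ℝ E] [NormedAddCommGroup F] [NormedSpace ℝ F] {C : E → F → ℝ}
    (hC : ContDiff ℝ 2 (fun x : E × F => C x.1 x.2)) {A : F → E} {A' : F →L[ℝ] E} {θ : F}
    (hA : HasFDerivAt A A' θ)
    (hcrit : ∀ᶠ ϑ in 𝓝 θ, fderiv ℝ (fun b => C b ϑ) (A ϑ) = 0) (h : F) :
    fderiv ℝ (fderiv ℝ (fun b => C b θ)) (A θ) (A' h)
      = - fderiv ℝ (fun ϑ => fderiv ℝ (fun b => C b ϑ) (A θ)) θ h := by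
  set G : E × F → E →L[ℝ] ℝ := fun x => fderiv ℝ (fun b => C b x.2) x.1
  have hGd : Differentiable ℝ G := hC.differentiable_fderiv_fst
  have hG' := (hGd (A θ, θ)).hasFDerivAt
  have h1 := (HasFDerivAt.comp (f := fun b => (b, θ)) (A θ) hG'
    (hasFDerivAt_prodMk_left (A θ) θ)).fderiv
  have h2 := (HasFDerivAt.comp (f := fun ϑ => (A θ, ϑ)) θ hG'
    (hasFDerivAt_prodMk_right (A θ) θ)).fderiv
  have h3 : HasFDerivAt (fun ϑ => G (A ϑ, ϑ))
      ((fderiv ℝ G (A θ, θ)).comp (A'.prod (ContinuousLinearMap.id ℝ F))) θ :=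
    HasFDerivAt.comp (f := fun ϑ => (A ϑ, ϑ)) θ hG' (hA.prodMk (hasFDerivAt_id θ))
  have h4 : HasFDerivAt (fun ϑ => G (A ϑ, ϑ)) (0 : F →L[ℝ] E →L[ℝ] ℝ) θ :=
    (hasFDerivAt_const (0 : E →L[ℝ] ℝ) θ).congr_of_eventuallyEq hcrit
  have h5 := DFunLike.congr_fun (h3.unique h4) h
  change fderiv ℝ (G ∘ fun b => (b, θ)) (A θ) (A' h)
      = - fderiv ℝ (G ∘ fun ϑ => (A θ, ϑ)) θ h
  rw [h1, h2, eq_neg_iff_add_eq_zero]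
  rw [ContinuousLinearMap.comp_apply, ContinuousLinearMap.comp_apply, ← map_add]
  simpa using h5

/-- The derivative of a map into linear forms, expressed through its matrix of partial
derivatives. -/
theorem fderiv_apply_apply_eq_dotProduct_mulVec {m n : ℕ}
    {T : (Fin m → ℝ) → (Fin n → ℝ) →L[ℝ] ℝ} {x : Fin m → ℝ} (hT : DifferentiableAt ℝ T x)
    {M : Matrix (Fin m) (Fin n) ℝ}
    (hM : ∀ i j, M i j = fderiv ℝ (fun y => T y (Pi.single j 1)) x (Pi.single i 1))
    (v : Fin m → ℝ) (w : Fin n → ℝ) : fderiv ℝ T x v w = v ⬝ᵥ M *ᵥ w := by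
  have hM' : ∀ i j, M i j = fderiv ℝ T x (Pi.single i 1) (Pi.single j 1) := by
    intro i j
    rw [hM, (hT.hasFDerivAt.clm_apply (hasFDerivAt_const (Pi.single j (1 : ℝ)) x)).fderiv]
    simp
  have hv : fderiv ℝ T x v w = ∑ i, v i * fderiv ℝ T x (Pi.single i 1) w := by
    conv_lhs => rw [pi_eq_sum_univ' v]
    simp
  have hw : ∀ L : (Fin n → ℝ) →L[ℝ] ℝ, L w = ∑ j, L (Pi.single j 1) * w j := by
    intro L
    conv_lhs => rw [pi_eq_sum_univ' w]
    simp [mul_comm]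
  simp only [hv, hw, dotProduct, mulVec, hM']

/-- Convergence in distribution tested against bounded continuous functions. -/
theorem tendstoInDistribution_iff_forall_integral {Ω E : Type*} [MeasurableSpace Ω]
    {P : Measure Ω} [IsProbabilityMeasure P] [TopologicalSpace E] [MeasurableSpace E]
    [OpensMeasurableSpace E]
    {X : ℕ → Ω → E} {Z : Ω → E} (hX : ∀ n, AEMeasurable (X n) P) (hZ : AEMeasurable Z P) :
    TendstoInDistribution X atTop Z (fun _ => P) P ↔
      ∀ f : BoundedContinuousFunction E ℝ,
        Tendsto (fun n => ∫ ω, f (X n ω) ∂P) atTop (𝓝 (∫ ω, f (Z ω) ∂P)) := by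
  have hint : ∀ (f : BoundedContinuousFunction E ℝ) {Y : Ω → E}, AEMeasurable Y P →
      ∫ x, f x ∂(P.map Y) = ∫ ω, f (Y ω) ∂P := fun f Y hY =>
    integral_map hY f.continuous.measurable.aestronglyMeasurable
  constructor
  · intro h f
    have := ProbabilityMeasure.tendsto_iff_forall_integral_tendsto.1 h.tendsto f
    simpa only [ProbabilityMeasure.coe_mk, hint f (hX _), hint f hZ] using this
  · intro h
    refine ⟨hX, hZ, ProbabilityMeasure.tendsto_iff_forall_integral_tendsto.2 fun f => ?_⟩
    simpa only [ProbabilityMeasure.coe_mk, hint f (hX _), hint f hZ] using h f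

/-- Convergence in distribution to `0` implies that functions vanishing and continuous at `0` of the
variables tend to `0` in probability. -/
theorem TendstoInDistribution.tendstoInMeasure_comp_zero {Ω E : Type*}
    [MeasurableSpace Ω] {P : Measure Ω} [IsProbabilityMeasure P] [NormedAddCommGroup E]
    [MeasurableSpace E] [BorelSpace E] {X : ℕ → Ω → E}
    (hX : TendstoInDistribution X atTop (fun _ => (0 : E)) (fun _ => P) P)
    {ρ : E → ℝ} (hρ : Tendsto ρ (𝓝 0) (𝓝 0)) :
    TendstoInMeasure P (fun n ω => ρ (X n ω)) atTop (fun _ => 0) := by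
  rw [tendstoInMeasure_iff_norm]
  intro ε hε
  obtain ⟨δ, hδ, hball⟩ := Metric.eventually_nhds_iff_ball.1
    (hρ.eventually (Metric.ball_mem_nhds 0 hε))
  have hmeas : MeasurableSet (Metric.ball (0 : E) δ)ᶜ := measurableSet_ball.compl
  have hlim := ProbabilityMeasure.tendsto_measure_of_null_frontier_of_tendsto' hX.tendsto
    (E := (Metric.ball (0 : E) δ)ᶜ) (by
      simp only [ProbabilityMeasure.coe_mk, frontier_compl]
      rw [Measure.map_const, measure_univ, one_smul]
      rw [Measure.dirac_apply' _ measurableSet_frontier]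
      simp [frontier, interior_eq_iff_isOpen.2 Metric.isOpen_ball, hδ])
  simp only [ProbabilityMeasure.coe_mk] at hlim
  rw [Measure.map_const, measure_univ, one_smul, Measure.dirac_apply' _ hmeas] at hlim
  simp only [Set.indicator, Set.mem_compl_iff, Metric.mem_ball_self hδ, not_true_eq_false,
    if_false] at hlim
  refine tendsto_of_tendsto_of_tendsto_of_le_of_le tendsto_const_nhds hlim
    (fun _ => zero_le) fun n => ?_
  change _ ≤ (P.map (X n)) _
  rw [Measure.map_apply_of_aemeasurable (hX.forall_aemeasurable n) hmeas]
  refine measure_mono fun ω hω => ?_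
  by_contra hmem
  have := hball (X n ω) (by simpa using hmem)
  simp only [Set.mem_ofPred_eq, sub_zero, dist_zero_right] at hω this
  linarith

/-- Second-order delta method. -/
theorem tendstoInDistribution_of_isLittleO_sq {Ω E : Type*} [MeasurableSpace Ω] {P : Measure Ω}
    [IsProbabilityMeasure P] [NormedAddCommGroup E] [NormedSpace ℝ E] [SecondCountableTopology E]
    [MeasurableSpace E] [BorelSpace E] {T : ℕ → Ω → E} {θ : E} {N : Ω → E}
    (hT : TendstoInDistribution (fun (n : ℕ) ω => √(n : ℝ) • (T n ω - θ)) atTop N (fun _ => P) P)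
    {G : E → ℝ} (hG : Measurable G) {Q : E → ℝ} (hQ : Continuous Q)
    (hhom : ∀ (c : ℝ) (h : E), Q (c • h) = c ^ 2 * Q h)
    (hTm : ∀ n, Measurable (T n))
    (hGQ : (fun x => G x - Q (x - θ)) =o[𝓝 θ] fun x => ‖x - θ‖ ^ 2) :
    TendstoInDistribution (fun (n : ℕ) ω => (n : ℝ) * G (T n ω)) atTop (fun ω => Q (N ω))
      (fun _ => P) P := by
  set ρ : E → ℝ := fun h => (G (θ + h) - Q h) / ‖h‖ ^ 2 with hρdef
  have hρm : Measurable ρ :=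
    ((hG.comp (measurable_const_add θ)).sub hQ.measurable).div (measurable_norm.pow_const 2)
  have hshift : Tendsto (fun h : E => θ + h) (𝓝 0) (𝓝 θ) := by
    simpa using (continuous_const_add θ).tendsto (0 : E)
  have hρ : Tendsto ρ (𝓝 0) (𝓝 0) := by
    simpa [Function.comp_def, hρdef] using hGQ.tendsto_div_nhds_zero.comp hshift
  have hG0 : G θ = Q 0 := by
    simpa [sub_eq_zero] using hGQ.isBigO.eq_zero_of_norm_pow (by simp)
  have hmul : ∀ h : E, ρ h * ‖h‖ ^ 2 = G (θ + h) - Q h := by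
    intro h
    rcases eq_or_ne h 0 with rfl | hh
    · simp [hG0]
    · exact div_mul_cancel₀ _ (by simpa using hh)
  have hinv : TendstoInMeasure P (fun (n : ℕ) (_ : Ω) => (√(n : ℝ))⁻¹) atTop (fun _ => (0 : ℝ)) := by
    refine tendstoInMeasure_of_tendsto_ae (fun n => aestronglyMeasurable_const)
      (Eventually.of_forall fun _ => ?_)
    exact (Real.tendsto_sqrt_atTop.comp tendsto_natCast_atTop_atTop).inv_tendsto_atTop
  have hsmall := hT.continuous_comp_prodMk_of_tendstoInMeasure_const
    (g := fun x : E × ℝ => x.2 • x.1) (by fun_prop) hinv (fun _ => aemeasurable_const)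
  simp only [zero_smul] at hsmall
  have hρT : TendstoInMeasure P (fun n ω => ρ (T n ω - θ)) atTop (fun _ => 0) := by
    refine (TendstoInDistribution.tendstoInMeasure_comp_zero hsmall hρ).congr' ?_ .rfl
    filter_upwards [eventually_gt_atTop 0] with n hn
    refine Eventually.of_forall fun ω => ?_
    have : √(n : ℝ) ≠ 0 := by positivity
    simp [smul_smul, this]
  have hfin := hT.continuous_comp_prodMk_of_tendstoInMeasure_const
    (g := fun x : E × ℝ => Q x.1 + x.2 * ‖x.1‖ ^ 2) (by fun_prop) hρT
    (fun n => (hρm.comp ((hTm n).sub_const θ)).aemeasurable)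
  simp only [zero_mul, add_zero] at hfin
  convert hfin using 3 with n ω
  rw [hhom, norm_smul, mul_pow, Real.norm_eq_abs, sq_abs, Real.sq_sqrt n.cast_nonneg,
    mul_left_comm, hmul, add_sub_cancel]
  ring

/-- **degradation asymptotics for smooth criteria.**
Let `C : ℝ^p × ℝ^q → ℝ` be twice continuously differentiable, `θ` and `a` with
`∇_a C(a,θ) = 0`, Hessian `Caa = ∇²_{aa} C(a,θ)` positive definite and mixed
second-derivative matrix `Caθ = (∂²C/∂aᵢ∂θⱼ)(a,θ)`. For `ϑ` near `θ`, `A ϑ` is the unique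
local minimizer of `C(·,ϑ)` near `a` (so `A θ = a`), continuously differentiable by the
implicit function theorem. If `√n (θ̂_n − θ)` converges in distribution to a centered
Gaussian `N` with covariance `S`, then `n (C(A θ̂_n, θ) − C(a,θ))` converges in
distribution to the Gaussian quadratic form `Nᵀ Q N`, `Q = ½ Caθᵀ Caa⁻¹ Caθ`. -/
theorem degradation_asymptotics_smooth
    {p q : ℕ} {Ω : Type*} [MeasurableSpace Ω] (P : Measure Ω) [IsProbabilityMeasure P]
    (C : (Fin p → ℝ) → (Fin q → ℝ) → ℝ)
    (hC : ContDiff ℝ 2 (fun x : (Fin p → ℝ) × (Fin q → ℝ) => C x.1 x.2))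
    (θ : Fin q → ℝ) (a : Fin p → ℝ)
    (hcrit : fderiv ℝ (fun b => C b θ) a = 0)
    (Caa : Matrix (Fin p) (Fin p) ℝ)
    (hCaa : ∀ i j, Caa i j =
      fderiv ℝ (fun b => fderiv ℝ (fun b' => C b' θ) b (Pi.single j 1)) a (Pi.single i 1))
    (hCaaPD : Caa.PosDef)
    (Caθ : Matrix (Fin p) (Fin q) ℝ)
    (hCaθ : ∀ i j, Caθ i j =
      fderiv ℝ (fun ϑ => fderiv ℝ (fun b => C b ϑ) a (Pi.single i 1)) θ (Pi.single j 1))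
    -- `A ϑ` is the unique local minimizer of `C(·,ϑ)` near `a`, with `A θ = a`,
    -- continuously differentiable at `θ` (implicit function theorem):
    (A : (Fin q → ℝ) → (Fin p → ℝ)) (hAmeas : Measurable A)
    (hAθ : A θ = a) (hAc1 : ContDiffAt ℝ 1 A θ)
    (hAcrit : ∀ᶠ ϑ in 𝓝 θ, fderiv ℝ (fun b => C b ϑ) (A ϑ) = 0)
    (hAmin : ∀ᶠ ϑ in 𝓝 θ, IsLocalMin (fun b => C b ϑ) (A ϑ))
    (r : ℝ) (hr : 0 < r)
    (hAuniq : ∀ᶠ ϑ in 𝓝 θ, ∀ b ∈ Metric.ball a r,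
      IsLocalMin (fun b' => C b' ϑ) b → b = A ϑ)
    -- `√n (θ̂_n − θ) →_d N ∼ N(0, S)`:
    (θhat : ℕ → Ω → (Fin q → ℝ)) (hθhat : ∀ n, Measurable (θhat n))
    (N : Ω → (Fin q → ℝ)) (hNmeas : Measurable N)
    (S : Matrix (Fin q) (Fin q) ℝ) (hS : S.PosSemidef)
    (hNgauss : ∀ u : Fin q → ℝ,
      Measure.map (fun ω => u ⬝ᵥ N ω) P = gaussianReal 0 (u ⬝ᵥ S.mulVec u).toNNReal)
    (hconv : ∀ f : BoundedContinuousFunction (Fin q → ℝ) ℝ,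
      Tendsto (fun n : ℕ => ∫ ω, f (fun i => Real.sqrt n * (θhat n ω i - θ i)) ∂P)
        atTop (𝓝 (∫ ω, f (N ω) ∂P))) :
    -- `n (C(A θ̂_n, θ) − C(a, θ)) →_d Nᵀ Q N` with `Q = ½ Caθᵀ Caa⁻¹ Caθ`:
    ∀ f : BoundedContinuousFunction ℝ ℝ,
      Tendsto (fun n : ℕ => ∫ ω, f ((n : ℝ) * (C (A (θhat n ω)) θ - C a θ)) ∂P)
        atTop
        (𝓝 (∫ ω, f (N ω ⬝ᵥ (((1 : ℝ) / 2) • (Caθᵀ * Caa⁻¹ * Caθ)).mulVec (N ω)) ∂P)) := by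
  have hA := (hAc1.differentiableAt (by simp)).hasFDerivAt
  have hg : ContDiff ℝ 2 (fun b => C b θ) := hC.comp (contDiff_id.prodMk contDiff_const)
  have hexp := isLittleO_comp_sub_half_sndFDeriv hg hA (by rwa [hAθ])
  have hfirst := sndFDeriv_apply_of_eventually_critical hC hA hAcrit
  rw [hAθ] at hexp hfirst
  have hB := fderiv_apply_apply_eq_dotProduct_mulVec
    ((hg.fderiv_right (m := 1) le_rfl).differentiable (by simp) a) hCaa
  have hD := fderiv_apply_apply_eq_dotProduct_mulVec (M := Caθᵀ)
    (T := fun ϑ => fderiv ℝ (fun b => C b ϑ) a)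
    ((hC.differentiable_fderiv_fst (a, θ)).comp θ
      (f := fun ϑ => (a, ϑ)) (by fun_prop)) (fun i j => hCaθ j i)
  have hquad : ∀ h, 1 / 2 * fderiv ℝ (fderiv ℝ (fun b => C b θ)) a
      (fderiv ℝ A θ h) (fderiv ℝ A θ h)
      = h ⬝ᵥ ((1 / 2 : ℝ) • (Caθᵀ * Caa⁻¹ * Caθ)) *ᵥ h := by
    intro h
    have hform : ∀ w, fderiv ℝ A θ h ⬝ᵥ Caa *ᵥ w = -(h ⬝ᵥ Caθᵀ *ᵥ w) := by
      intro w
      rw [← hB, ← hD, hfirst]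
      rfl
    have hsolve := hform (Caa⁻¹ *ᵥ Caθ *ᵥ h)
    rw [mulVec_mulVec, mul_nonsing_inv _ hCaaPD.det_pos.ne'.isUnit, one_mulVec] at hsolve
    rw [hB, hform, dotProduct_mulVec, vecMul_transpose, dotProduct_comm, hsolve, neg_neg,
      smul_mulVec, dotProduct_smul, smul_eq_mul, ← mulVec_mulVec, ← mulVec_mulVec]
  simp only [hquad] at hexp
  have hCθ : Continuous (fun b => C b θ) := hg.continuous
  have hscaled : ∀ n : ℕ, Measurable fun ω => √(n : ℝ) • (θhat n ω - θ) := fun n =>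
    ((hθhat n).sub_const θ).const_smul √(n : ℝ)
  have hT : TendstoInDistribution (fun (n : ℕ) ω => √(n : ℝ) • (θhat n ω - θ)) atTop N
      (fun _ => P) P :=
    (tendstoInDistribution_iff_forall_integral (fun n => (hscaled n).aemeasurable)
      hNmeas.aemeasurable).2 hconv
  have hlim := tendstoInDistribution_of_isLittleO_sq hT
    (G := fun ϑ => C (A ϑ) θ - C a θ) ((hCθ.measurable.comp hAmeas).sub_const _)
    (Q := fun h => h ⬝ᵥ ((1 / 2 : ℝ) • (Caθᵀ * Caa⁻¹ * Caθ)) *ᵥ h) (by fun_prop)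
    (fun c h => by
      simp only [mulVec_smul, dotProduct_smul, smul_dotProduct, smul_eq_mul]
      ring)
    hθhat hexp
  exact (tendstoInDistribution_iff_forall_integral hlim.forall_aemeasurable
    hlim.aemeasurable_limit).1 hlim
end

section
/- Let X be a real random variable, ε ∈ (0,1), and let x_ε = inf{x : P(X > x) ≤ ε} be its Value at Risk at level ε. Let 0 ≤ a₁ ≤ a₂ with a₁ ≤ x_ε, let I_a(x) = max(x−a₁,0) − max(x−a₂,0) be the one-layer contract, and let R = X − I_a(X) be the retained loss. Then VaR_ε(R) = max(x_ε − a₂, 0) + a₁. In particular, if a₂ ≥ x_ε then VaR_ε(R) = a₁, and if a₂ < x_ε then VaR_ε(R) = x_ε − (a₂ − a₁). -/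
open MeasureTheory

/-- Value at Risk at level `ε` of the real random variable `Y` under the probability
measure `P`: `VaR_ε(Y) = inf {x : P(Y > x) ≤ ε}`. -/
noncomputable def VaR {Ω : Type*} [MeasurableSpace Ω] (P : Measure Ω) (ε : ℝ)
    (Y : Ω → ℝ) : ℝ :=
  sInf {x : ℝ | P {ω | x < Y ω} ≤ ENNReal.ofReal ε}

open ProbabilityTheory

/-- The superlevel sets of a cumulative distribution function at levels in `(0, 1)` are
closed half-lines. -/
theorem setOf_le_cdf_eq_Ici (μ : Measure ℝ) {p : ℝ} (hp : p ∈ Set.Ioo (0 : ℝ) 1) :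
    {x : ℝ | p ≤ cdf μ x} = Set.Ici (sInf {x : ℝ | p ≤ cdf μ x}) := by
  set S := {x : ℝ | p ≤ cdf μ x}
  have hne : S.Nonempty := ((tendsto_cdf_atTop μ).eventually (Ici_mem_nhds hp.2)).exists
  have hbdd : BddBelow S := by
    obtain ⟨b, hb⟩ := ((tendsto_cdf_atBot μ).eventually (Iio_mem_nhds hp.1)).exists
    refine ⟨b, fun x hx => ?_⟩
    by_contra! hlt
    exact absurd (hx.trans (monotone_cdf μ hlt.le)) (not_le.mpr hb)
  have hmem : sInf S ∈ S := by
    have hcont : Filter.Tendsto (cdf μ) (nhdsWithin (sInf S) (Set.Ioi (sInf S)))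
        (nhds (cdf μ (sInf S))) :=
      ((cdf μ).right_continuous (sInf S)).mono Set.Ioi_subset_Ici_self
    refine ge_of_tendsto hcont (Filter.eventually_of_mem self_mem_nhdsWithin fun x hx => ?_)
    obtain ⟨y, hy, hyx⟩ := exists_lt_of_csInf_lt hne hx
    exact le_trans hy (monotone_cdf μ hyx.le)
  ext x
  exact ⟨fun hx => csInf_le hbdd hx, fun hx => le_trans hmem (monotone_cdf μ hx)⟩

theorem measure_lt_le_ofReal_iff_le_cdf {Ω : Type*} [MeasurableSpace Ω] (P : Measure Ω)
    [IsProbabilityMeasure P] {X : Ω → ℝ} (hX : Measurable X) {ε : ℝ} (hε : 0 ≤ ε) (x : ℝ) :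
    P {ω | x < X ω} ≤ ENNReal.ofReal ε ↔ 1 - ε ≤ cdf (P.map X) x := by
  have := Measure.isProbabilityMeasure_map (μ := P) hX.aemeasurable
  have hcompl : {ω | x < X ω} = (X ⁻¹' Set.Iic x)ᶜ := by
    ext ω
    simp
  rw [cdf_eq_real, map_measureReal_apply hX measurableSet_Iic, hcompl,
    ENNReal.le_ofReal_iff_toReal_le (measure_ne_top _ _) hε, ← measureReal_def,
    probReal_compl_eq_one_sub (hX measurableSet_Iic)]
  exact sub_le_comm

/-- The tail probability at `x` is at most `ε` exactly when `x` is at least the Value at Risk. -/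
theorem measure_lt_le_ofReal_iff_VaR_le {Ω : Type*} [MeasurableSpace Ω] (P : Measure Ω)
    [IsProbabilityMeasure P] {X : Ω → ℝ} (hX : Measurable X) {ε : ℝ}
    (hε : ε ∈ Set.Ioo (0 : ℝ) 1) (x : ℝ) :
    P {ω | x < X ω} ≤ ENNReal.ofReal ε ↔ VaR P ε X ≤ x := by
  have hp : 1 - ε ∈ Set.Ioo (0 : ℝ) 1 := ⟨sub_pos.mpr hε.2, sub_lt_self 1 hε.1⟩
  have hx := Set.ext_iff.mp (setOf_le_cdf_eq_Ici (P.map X) hp) x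
  simpa only [VaR, measure_lt_le_ofReal_iff_le_cdf P hX hε.1.le, Set.mem_ofPred_eq, Set.mem_Ici]
    using hx

theorem lt_retained_iff_of_lt {a₁ a₂ x y : ℝ} (h₁₂ : a₁ ≤ a₂) (hx : x < a₁) :
    x < y - (max (y - a₁) 0 - max (y - a₂) 0) ↔ x < y := by
  grind

theorem lt_retained_iff_of_le {a₁ a₂ x y : ℝ} (h₁₂ : a₁ ≤ a₂) (hx : a₁ ≤ x) :
    x < y - (max (y - a₁) 0 - max (y - a₂) 0) ↔ x + (a₂ - a₁) < y := by
  grind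

/-- Let `X` be a real random variable, `ε ∈ (0,1)`, `x_ε = VaR_ε(X)`.
For a one-layer contract `I_a(x) = max(x−a₁,0) − max(x−a₂,0)` with `0 ≤ a₁ ≤ a₂` and
`a₁ ≤ x_ε`, the retained loss `R = X − I_a(X)` satisfies
`VaR_ε(R) = max(x_ε − a₂, 0) + a₁`; in particular, `VaR_ε(R) = a₁` if `a₂ ≥ x_ε` and
`VaR_ε(R) = x_ε − (a₂ − a₁)` if `a₂ < x_ε`. -/
theorem VaR_retained_one_layer
    {Ω : Type*} [MeasurableSpace Ω] (P : Measure Ω) [IsProbabilityMeasure P]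
    (X : Ω → ℝ) (hX : Measurable X)
    (ε : ℝ) (hε : ε ∈ Set.Ioo (0 : ℝ) 1)
    (a₁ a₂ : ℝ) (ha₁ : 0 ≤ a₁) (h₁₂ : a₁ ≤ a₂)
    (ha₁x : a₁ ≤ VaR P ε X) :
    VaR P ε (fun ω => X ω - (max (X ω - a₁) 0 - max (X ω - a₂) 0)) =
      max (VaR P ε X - a₂) 0 + a₁ ∧
    (VaR P ε X ≤ a₂ →
      VaR P ε (fun ω => X ω - (max (X ω - a₁) 0 - max (X ω - a₂) 0)) = a₁) ∧
    (a₂ < VaR P ε X →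
      VaR P ε (fun ω => X ω - (max (X ω - a₁) 0 - max (X ω - a₂) 0)) =
        VaR P ε X - (a₂ - a₁)) := by
  have hmain : VaR P ε (fun ω => X ω - (max (X ω - a₁) 0 - max (X ω - a₂) 0)) =
      max (VaR P ε X - a₂) 0 + a₁ := by
    rw [VaR, ← csInf_Ici (a := max (VaR P ε X - a₂) 0 + a₁)]
    congr 1
    ext x
    rw [Set.mem_ofPred_eq, Set.mem_Ici]
    rcases lt_or_ge x a₁ with hx | hx
    · simp only [lt_retained_iff_of_lt h₁₂ hx]
      rw [measure_lt_le_ofReal_iff_VaR_le P hX hε]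
      grind
    · simp only [lt_retained_iff_of_le h₁₂ hx]
      rw [measure_lt_le_ofReal_iff_VaR_le P hX hε]
      grind
  refine ⟨hmain, fun h => ?_, fun h => ?_⟩
  · rw [hmain, max_eq_right (sub_nonpos.mpr h), zero_add]
  · rw [hmain, max_eq_left (sub_pos.mpr h).le]
    ring
end
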